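/- Let η : ℝ² → [0,∞) satisfy η(0,0) = 0 and suppose the set η⁻¹([0,1)) = {t ∈ ℝ² : η(t) < 1} is path-connected. Then the set W_η is nonempty (it contains the point (1,1,1)) and path-connected. -/

import Mathlib

open Complex

/-- The worm-type set `W_η ⊆ ℂ³`. -/
noncomputable def wormSet (η : ℝ × ℝ → ℝ) : Set (ℂ × ℂ × ℂ) :=
  {z | z.2.1 ≠ 0 ∧ z.2.2 ≠ 0 ∧
    ‖z.1 - Complex.exp (Complex.I *
        ((Real.log (‖z.2.1 * z.2.2‖ ^ 2) : ℝ) : ℂ))‖ ^ 2 <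
      1 - η (Real.log (‖z.2.1‖ ^ 2), Real.log (‖z.2.2‖ ^ 2))}

/-- Parametrization of the centre set by logarithmic and angular coordinates. -/
noncomputable def wormParam (p : (ℝ × ℝ) × ℝ × ℝ) : ℂ × ℂ × ℂ :=
  (Complex.exp (Complex.I * ((p.1.1 + p.1.2 : ℝ) : ℂ)),
    Complex.exp (((p.1.1 / 2 : ℝ) : ℂ) + (p.2.1 : ℂ) * Complex.I),
    Complex.exp (((p.1.2 / 2 : ℝ) : ℂ) + (p.2.2 : ℂ) * Complex.I))

lemma wormParam_continuous : Continuous wormParam := by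
  unfold wormParam
  fun_prop

lemma worm_log_mul {z w : ℂ} (hz : z ≠ 0) (hw : w ≠ 0) :
    Real.log (‖z * w‖ ^ 2) = Real.log (‖z‖ ^ 2) + Real.log (‖w‖ ^ 2) := by
  rw [norm_mul, mul_pow, Real.log_mul]
  · exact pow_ne_zero _ (norm_ne_zero_iff.2 hz)
  · exact pow_ne_zero _ (norm_ne_zero_iff.2 hw)

lemma worm_log_exp (s a : ℝ) :
    Real.log (‖Complex.exp (((s / 2 : ℝ) : ℂ) + (a : ℂ) * Complex.I)‖ ^ 2) = s := by
  rw [Complex.norm_exp, Real.log_pow, Real.log_exp]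
  simp
  ring

lemma worm_exp_log {z : ℂ} (hz : z ≠ 0) :
    Complex.exp (((Real.log (‖z‖ ^ 2) / 2 : ℝ) : ℂ) + (Complex.arg z : ℂ) * Complex.I) = z := by
  have h : Real.log (‖z‖ ^ 2) / 2 = Real.log ‖z‖ := by
    rw [Real.log_pow]; push_cast; ring
  rw [h]
  exact Complex.exp_log hz

lemma wormParam_mem (η : ℝ × ℝ → ℝ) (p : (ℝ × ℝ) × ℝ × ℝ) (hp : η p.1 < 1) :
    wormParam p ∈ wormSet η := by
  refine ⟨Complex.exp_ne_zero _, Complex.exp_ne_zero _, ?_⟩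
  simp only [wormParam]
  rw [worm_log_mul (Complex.exp_ne_zero _) (Complex.exp_ne_zero _)]
  simp only [worm_log_exp]
  simpa using hp

theorem wormSet_pathConnected (η : ℝ × ℝ → ℝ) (hnn : ∀ t, 0 ≤ η t)
    (h0 : η (0, 0) = 0) (hpc : IsPathConnected {t : ℝ × ℝ | η t < 1}) :
    ((1 : ℂ), (1 : ℂ), (1 : ℂ)) ∈ wormSet η ∧ IsPathConnected (wormSet η) := by
  have h1 : ((1 : ℂ), (1 : ℂ), (1 : ℂ)) ∈ wormSet η := by
    simp [wormSet, h0]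
  refine ⟨h1, ?_⟩
  have hS : IsPathConnected ({t : ℝ × ℝ | η t < 1} ×ˢ (Set.univ : Set (ℝ × ℝ))) :=
    hpc.prod isPathConnected_univ
  have hC := hS.image wormParam_continuous
  have hsub : wormParam '' ({t : ℝ × ℝ | η t < 1} ×ˢ (Set.univ : Set (ℝ × ℝ))) ⊆ wormSet η := by
    rintro _ ⟨p, hp, rfl⟩
    exact wormParam_mem η p hp.1
  have hone : ((1 : ℂ), (1 : ℂ), (1 : ℂ)) ∈
      wormParam '' ({t : ℝ × ℝ | η t < 1} ×ˢ (Set.univ : Set (ℝ × ℝ))) := by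
    refine ⟨((0, 0), (0, 0)), ⟨?_, trivial⟩, by simp [wormParam]⟩
    simp [h0]
  refine ⟨_, h1, ?_⟩
  rintro ⟨z, u, v⟩ ⟨hu, hv, hz⟩
  simp only at hu hv hz
  set c := Complex.exp (Complex.I * ((Real.log (‖u * v‖ ^ 2) : ℝ) : ℂ)) with hc
  have hη : η (Real.log (‖u‖ ^ 2), Real.log (‖v‖ ^ 2)) < 1 := by
    nlinarith [sq_nonneg ‖z - c‖]
  have hcm : (c, u, v) ∈
      wormParam '' ({t : ℝ × ℝ | η t < 1} ×ˢ (Set.univ : Set (ℝ × ℝ))) := by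
    refine ⟨((Real.log (‖u‖ ^ 2), Real.log (‖v‖ ^ 2)), (Complex.arg u, Complex.arg v)),
      ⟨hη, trivial⟩, ?_⟩
    simp only [wormParam, worm_exp_log hu, worm_exp_log hv, hc, worm_log_mul hu hv]
  refine ((hC.joinedIn _ hone _ hcm).mono hsub).trans ?_
  refine JoinedIn.ofLine (f := fun t : ℝ => (c + (t : ℂ) * (z - c), u, v)) ?_ ?_ ?_ ?_
  · fun_prop
  · simp
  · simp
  · rintro _ ⟨t, ht, rfl⟩
    refine ⟨hu, hv, lt_of_le_of_lt ?_ hz⟩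
    change ‖c + (t : ℂ) * (z - c) - c‖ ^ 2 ≤ ‖z - c‖ ^ 2
    rw [add_sub_cancel_left, norm_mul, Complex.norm_real, Real.norm_eq_abs,
      abs_of_nonneg ht.1]
    have := mul_le_of_le_one_left (norm_nonneg (z - c)) ht.2
    have h2 := mul_nonneg ht.1 (norm_nonneg (z - c))
    exact pow_le_pow_left₀ h2 this 2
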